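/- Let E ⊂ (0,T) be a measurable set of positive Lebesgue measure and let ℓ ∈ (0,T) be a density point of E, i.e. |E ∩ (ℓ−θ, ℓ+θ)|/(2θ) → 1 as θ → 0⁺. Then for each z > 1 there exists ℓ₁ ∈ (ℓ,T) such that the sequence defined by ℓ_{m+1} = ℓ + z^{−m}(ℓ₁ − ℓ) for m ≥ 1 satisfies ℓ_m − ℓ_{m+1} ≤ 3·|E ∩ (ℓ_{m+1}, ℓ_m)| for every m ≥ 1. -/

import Mathlib

open MeasureTheory Set Filter

/-- Inside `(a, b)`, the part of `E` lying to the left of `c` has measure at most `c - a`. -/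
theorem volume_real_inter_Ioo_le (E : Set ℝ) {a b c : ℝ} (hac : a ≤ c) :
    volume.real (E ∩ Ioo a b) ≤ (c - a) + volume.real (E ∩ Ioo c b) := by
  have hfin : volume (E ∩ Ioo c b) ≠ ⊤ :=
    measure_ne_top_of_subset inter_subset_right measure_Ioo_lt_top.ne
  have hsub : E ∩ Ioo a b ⊆ Ioc a c ∪ (E ∩ Ioo c b) := fun x hx =>
    (le_or_gt x c).imp (fun h => ⟨hx.2.1, h⟩) (fun h => ⟨hx.1, h, hx.2.2⟩)
  calc volume.real (E ∩ Ioo a b)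
      ≤ volume.real (Ioc a c ∪ (E ∩ Ioo c b)) :=
        measureReal_mono hsub (measure_union_ne_top measure_Ioc_lt_top.ne hfin)
    _ ≤ volume.real (Ioc a c) + volume.real (E ∩ Ioo c b) := measureReal_union_le _ _
    _ = (c - a) + volume.real (E ∩ Ioo c b) := by rw [Real.volume_real_Ioc_of_le hac]

/-- Near a density point `ℓ` of `E`, at least a third of each interval `(ℓ + t / z, ℓ + t)`
lies in `E`. -/
theorem exists_forall_sub_div_le_three_mul_volume_real (E : Set ℝ) (ℓ : ℝ)
    (hdens : Tendsto (fun θ : ℝ => (volume (E ∩ Ioo (ℓ - θ) (ℓ + θ))).toReal / (2 * θ))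
      (nhdsWithin 0 (Ioi 0)) (nhds 1)) {z : ℝ} (hz : 1 < z) :
    ∃ δ > 0, ∀ t ∈ Ioo 0 δ, t - t / z ≤ 3 * volume.real (E ∩ Ioo (ℓ + t / z) (ℓ + t)) := by
  have hz' : z⁻¹ < 1 := inv_lt_one_of_one_lt₀ hz
  have hev := hdens.eventually (lt_mem_nhds (show 1 - (1 - z⁻¹) / 3 < 1 by linarith))
  obtain ⟨δ, hδ, hsub⟩ := mem_nhdsGT_iff_exists_Ioo_subset.mp hev
  refine ⟨δ, hδ, fun t ht => ?_⟩
  have ht0 : 0 < t := ht.1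
  have hlow : 1 - (1 - z⁻¹) / 3 < volume.real (E ∩ Ioo (ℓ - t) (ℓ + t)) / (2 * t) := hsub ht
  rw [lt_div_iff₀ (by positivity)] at hlow
  have hdiv : 0 < t / z := by positivity
  have hup := volume_real_inter_Ioo_le E (b := ℓ + t) (show ℓ - t ≤ ℓ + t / z by linarith)
  rw [div_eq_mul_inv] at *
  linarith

/-- Proposition 2.1: given a density point `ℓ` of a measurable set
`E ⊆ (0,T)` of positive measure, for each `z > 1` one can choose `ℓ₁ ∈ (ℓ, T)` such that
the sequence `ℓ_m = ℓ + z^{-(m-1)} (ℓ₁ - ℓ)` satisfies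
`ℓ_m - ℓ_{m+1} ≤ 3 |E ∩ (ℓ_{m+1}, ℓ_m)|` for every `m ≥ 1`. -/
theorem density_point_sequence
    (T : ℝ) (hT : 0 < T)
    (E : Set ℝ) (hE : MeasurableSet E) (hET : E ⊆ Ioo 0 T) (hEpos : 0 < volume E)
    (ℓ : ℝ) (hℓ : ℓ ∈ Ioo 0 T)
    (hdens : Tendsto (fun θ : ℝ => (volume (E ∩ Ioo (ℓ - θ) (ℓ + θ))).toReal / (2 * θ))
      (nhdsWithin 0 (Ioi 0)) (nhds 1)) :
    ∀ z : ℝ, 1 < z → ∃ ℓ₁ ∈ Ioo ℓ T,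
      ∀ m : ℕ, 1 ≤ m →
        (ℓ + (ℓ₁ - ℓ) / z ^ (m - 1)) - (ℓ + (ℓ₁ - ℓ) / z ^ m) ≤
          3 * (volume (E ∩ Ioo (ℓ + (ℓ₁ - ℓ) / z ^ m) (ℓ + (ℓ₁ - ℓ) / z ^ (m - 1)))).toReal := by
  intro z hz
  obtain ⟨δ, hδ, h⟩ := exists_forall_sub_div_le_three_mul_volume_real E ℓ hdens hz
  obtain ⟨r, hr0, hr⟩ := exists_between (lt_min hδ (sub_pos.mpr hℓ.2))
  have hrT := hr.trans_le (min_le_right _ _)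
  refine ⟨ℓ + r, ⟨by linarith, by linarith⟩, fun m hm => ?_⟩
  obtain ⟨k, rfl⟩ := Nat.exists_eq_add_of_le' hm
  have hz0 : 0 < z := by linarith
  have hle : r / z ^ k ≤ r := div_le_self hr0.le (one_le_pow₀ hz.le)
  have key := h (r / z ^ k) ⟨by positivity, hle.trans_lt (hr.trans_le (min_le_left _ _))⟩
  rw [div_div, ← pow_succ] at key
  simpa only [add_sub_cancel_left, add_sub_add_left_eq_sub, Nat.add_sub_cancel, Measure.real] using key
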